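/- Let G_1, …, G_n be groups and let G ≤ G_1 × ⋯ × G_n be a subdirect product. Let Γ be a non-abelian limit group and φ : G → Γ a surjective homomorphism. Then φ factors through one of the coordinate projections: there exists i ∈ {1, …, n} such that G ∩ ker(p_i) ≤ ker(φ). -/

import Mathlib

/-- A group is *fully residually free* if for every finite subset there is a homomorphism
to a free group (equivalently, to the free group of rank 2) injective on that subset. -/
def FullyResiduallyFree (G : Type*) [Group G] : Prop :=
  ∀ A : Finset G, ∃ φ : G →* FreeGroup (Fin 2), Set.InjOn φ ↑A

/-- A *limit group* is a finitely generated fully residually free group. -/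
def IsLimitGroup (G : Type*) [Group G] : Prop :=
  Group.FG G ∧ FullyResiduallyFree G

/-- A nontrivial element of a free group on at least two generators is not central. -/
theorem FreeGroup.subsingleton_of_central {α : Type*} {a : FreeGroup α} (ha : a ≠ 1)
    (hc : ∀ b, a * b = b * a) : Subsingleton α := by
  classical
  by_contra hα
  rw [not_subsingleton_iff_nontrivial] at hα
  obtain ⟨w, p, hw⟩ := List.eq_nil_or_concat' a.toWord |>.resolve_left
    (by simpa using ha)
  obtain ⟨q, v, hv⟩ := List.exists_cons_of_ne_nil (l := a.toWord) (by simpa using ha)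
  obtain ⟨y, hy⟩ := exists_ne q.1
  have hred : FreeGroup.IsReduced a.toWord := FreeGroup.isReduced_toWord
  set l : α × Bool := (y, if p.1 = y then p.2 else true) with hl
  have hright : FreeGroup.IsReduced (a.toWord ++ [l]) := by
    rw [hw] at hred ⊢
    refine hred.append_overlap ?_ (by simp)
    simp only [List.singleton_append, FreeGroup.isReduced_cons_cons]
    exact ⟨fun h => (if_pos h).symm, FreeGroup.IsReduced.singleton⟩
  have hleft : FreeGroup.IsReduced (l :: a.toWord) := by
    rw [hv] at hred ⊢
    rw [FreeGroup.isReduced_cons_cons]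
    exact ⟨fun h => absurd h hy, hred⟩
  have h := congrArg FreeGroup.toWord (hc (FreeGroup.mk [l]))
  rw [FreeGroup.toWord_mul, FreeGroup.toWord_mul, FreeGroup.toWord_mk,
    FreeGroup.IsReduced.singleton.reduce_eq, hright.reduce_eq, List.singleton_append,
    hleft.reduce_eq, hv] at h
  simp only [List.cons_append, List.cons.injEq] at h
  exact hy (congrArg Prod.fst h.1).symm

theorem FreeGroup.isCyclic_of_subsingleton (α : Type*) [Subsingleton α] :
    IsCyclic (FreeGroup α) := by
  rcases isEmpty_or_nonempty α with _ | ⟨⟨i⟩⟩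
  · infer_instance
  · refine ⟨FreeGroup.of i, fun x => (?_ : x ∈ Subgroup.zpowers (FreeGroup.of i))⟩
    induction x using FreeGroup.induction_on with
    | C1 => exact one_mem _
    | of j => rw [Subsingleton.elim j i]; exact Subgroup.mem_zpowers _
    | inv_of j h => exact inv_mem h
    | mul x y hx hy => exact mul_mem hx hy

theorem IsFreeGroup.isCyclic_of_central {G : Type*} [Group G] [IsFreeGroup G] {a : G}
    (ha : a ≠ 1) (hc : ∀ b, a * b = b * a) : IsCyclic G := by
  let e := IsFreeGroup.toFreeGroup G
  have : Subsingleton (IsFreeGroup.Generators G) :=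
    FreeGroup.subsingleton_of_central (a := e a) (by simpa using ha) fun b => by
      obtain ⟨b, rfl⟩ := e.surjective b
      rw [← map_mul, hc, map_mul]
  have := FreeGroup.isCyclic_of_subsingleton (IsFreeGroup.Generators G)
  exact isCyclic_of_surjective e.symm e.symm.surjective

section Free

variable {F : Type*} [Group F] [IsFreeGroup F]

theorem IsFreeGroup.isCyclic_centralizer {a : F} (ha : a ≠ 1) :
    IsCyclic (Subgroup.centralizer {a}) :=
  IsFreeGroup.isCyclic_of_central
    (a := (⟨a, Subgroup.mem_centralizer_singleton_iff.2 rfl⟩ : Subgroup.centralizer {a}))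
    (by simpa [Subtype.ext_iff] using ha)
    fun b => Subtype.ext (Subgroup.mem_centralizer_singleton_iff.1 b.2).symm

theorem IsFreeGroup.exists_zpow_of_commute {a : F} (ha : a ≠ 1) :
    ∃ c, Commute a c ∧ ∀ b, Commute a b → ∃ k : ℤ, c ^ k = b := by
  obtain ⟨c, hc⟩ := IsFreeGroup.isCyclic_centralizer ha
  refine ⟨c, (Subgroup.mem_centralizer_singleton_iff.1 c.2).symm, fun b hb => ?_⟩
  obtain ⟨k, hk⟩ := hc ⟨b, Subgroup.mem_centralizer_singleton_iff.2 hb.symm⟩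
  exact ⟨k, congrArg Subtype.val hk⟩

theorem IsFreeGroup.commute_trans {a b c : F} (ha : a ≠ 1) (hb : Commute a b)
    (hc : Commute a c) : Commute b c := by
  obtain ⟨d, -, hd⟩ := IsFreeGroup.exists_zpow_of_commute ha
  obtain ⟨k, rfl⟩ := hd b hb
  obtain ⟨l, rfl⟩ := hd c hc
  exact (Commute.refl d).zpow_zpow k l

theorem IsFreeGroup.isMulTorsionFree : IsMulTorsionFree F :=
  (IsFreeGroup.toFreeGroup F).injective.isMulTorsionFree (IsFreeGroup.toFreeGroup F).toMonoidHom

/-- In a free group, an element conjugating `b ≠ 1` into its centralizer commutes with `b`. -/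
theorem IsFreeGroup.commute_of_commute_conj {b g : F} (hb : b ≠ 1)
    (h : Commute b (g * b * g⁻¹)) : Commute g b := by
  have := IsFreeGroup.isMulTorsionFree (F := F)
  obtain ⟨c, hbc, hc⟩ := IsFreeGroup.exists_zpow_of_commute hb
  obtain ⟨j, hj⟩ := hc b (Commute.refl b)
  have hc1 : c ≠ 1 := by
    rintro rfl
    exact hb (by simpa using hj.symm)
  have hb' : g * b * g⁻¹ ≠ 1 := by simpa using hb
  have hbg : Commute b (g * c * g⁻¹) :=
    IsFreeGroup.commute_trans hb' h.symm ((Commute.conj_iff g).2 hbc)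
  have h' : Commute b (g⁻¹ * b * g) := by
    have := (Commute.conj_iff g⁻¹).2 h
    simpa [mul_assoc] using this.symm
  have hb'' : g⁻¹ * b * g ≠ 1 := by
    simpa using (conj_eq_one_iff (a := g⁻¹) (b := b)).not.2 hb
  have hbg' : Commute b (g⁻¹ * c * g) :=
    IsFreeGroup.commute_trans hb'' h'.symm
      (by simpa using (Commute.conj_iff g⁻¹).2 hbc)
  obtain ⟨k, hk⟩ := hc _ hbg
  obtain ⟨m, hm⟩ := hc _ hbg'
  have hkm : c ^ (m * k) = c ^ (1 : ℤ) := by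
    rw [zpow_mul, hm, zpow_one]
    have : (g⁻¹ * c * g) ^ k = g⁻¹ * c ^ k * g := by
      simpa using conj_zpow (i := k) (a := g⁻¹) (b := c)
    rw [this, hk]
    group
  have hmk : m * k = 1 := injective_zpow_iff_not_isOfFinOrder.2 (not_isOfFinOrder_of_isMulTorsionFree hc1) hkm
  have hg2 : Commute (g ^ 2) c := by
    have hkk : k * k = 1 := by
      rcases Int.mul_eq_one_iff_eq_one_or_neg_one.1 hmk with ⟨-, rfl⟩ | ⟨-, rfl⟩ <;> rfl
    have h1 : g * (g * c * g⁻¹) * g⁻¹ = c := by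
      rw [← hk, ← conj_zpow, ← hk, ← zpow_mul, hkk, zpow_one]
    rw [commute_iff_eq, ← mul_inv_eq_iff_eq_mul]
    refine Eq.trans ?_ h1
    simp only [pow_two, mul_inv_rev, mul_assoc]
  have hgc : Commute g c := by
    by_cases hg : g ^ 2 = 1
    · rw [(pow_eq_one_iff_left two_ne_zero).1 hg]
      exact Commute.one_left c
    · exact IsFreeGroup.commute_trans hg (Commute.pow_self g 2) hg2
  exact hj ▸ hgc.zpow_right j

end Free

/-- Two nontrivial normal subgroups of a non-abelian fully residually free group do not
commute. -/
theorem FullyResiduallyFree.commutator_ne_bot {Γ : Type*} [Group Γ]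
    (hΓ : FullyResiduallyFree Γ) (hna : ∃ a b : Γ, a * b ≠ b * a) {A B : Subgroup Γ}
    [B.Normal] (hA : A ≠ ⊥) (hB : B ≠ ⊥) : ⁅A, B⁆ ≠ ⊥ := by
  classical
  intro hAB
  obtain ⟨g, h, hgh⟩ := hna
  obtain ⟨a, haA, ha⟩ := A.bot_or_exists_ne_one.resolve_left hA
  obtain ⟨b, hbB, hb⟩ := B.bot_or_exists_ne_one.resolve_left hB
  have hcomm : ∀ c ∈ B, Commute a c := fun c hc =>
    (Subgroup.mem_centralizer_iff.1 (Subgroup.commutator_eq_bot_iff_le_centralizer.1 hAB haA) c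
      hc).symm
  obtain ⟨f, hf⟩ := hΓ {1, a, b, g * h, h * g}
  have hfa : f a ≠ 1 := fun e => ha (hf (by simp) (by simp) (e.trans f.map_one.symm))
  have hfb : f b ≠ 1 := fun e => hb (hf (by simp) (by simp) (e.trans f.map_one.symm))
  have key : ∀ x, Commute (f b) (f x) := fun x =>
    (IsFreeGroup.commute_of_commute_conj hfb <| IsFreeGroup.commute_trans hfa
      ((hcomm b hbB).map f) (by
        simpa using (hcomm _ (Subgroup.Normal.conj_mem inferInstance b hbB x)).map f)).symm
  have : f (g * h) = f (h * g) := by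
    simpa using (IsFreeGroup.commute_trans hfb (key g) (key h)).eq
  exact hgh (hf (by simp) (by simp) this)


/-- **Proposition 6.12.** Any surjection from a subdirect product `H ≤ G₁ × ⋯ × G_n` onto
a non-abelian limit group `Γ` factors through one of the coordinate projections:
`H ∩ ker p_i ≤ ker φ` for some `i`. -/
theorem surjection_to_limit_group_factors
    {n : ℕ} (G : Fin n → Type*) [∀ i, Group (G i)]
    (H : Subgroup (∀ i, G i))
    (hsub : ∀ i, H.map (Pi.evalMonoidHom G i) = ⊤)
    (Γ : Type*) [Group Γ] (hΓ : IsLimitGroup Γ)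
    (hna : ∃ a b : Γ, a * b ≠ b * a)
    (φ : H →* Γ) (hφ : Function.Surjective φ) :
    ∃ i, (Pi.evalMonoidHom G i).ker.subgroupOf H ≤ φ.ker := by
  classical
  replace hΓ := hΓ.2
  by_contra! hne
  let K (i : Fin n) : Subgroup H := (Pi.evalMonoidHom G i).ker.subgroupOf H
  have key (S : Finset (Fin n)) : (S.inf K).map φ ≠ ⊥ := by
    induction S using Finset.induction_on with
    | empty =>
      intro h
      obtain ⟨a, b, hab⟩ := hna
      rw [Finset.inf_empty, Subgroup.map_top_of_surjective φ hφ] at h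
      have htriv (x : Γ) : x = 1 := Subgroup.mem_bot.1 (h ▸ Subgroup.mem_top x)
      exact hab (by rw [htriv a, htriv b])
    | insert i S _ ih =>
      intro h
      have hi : (K i).map φ ≠ ⊥ := fun hi => hne i ((Subgroup.map_eq_bot_iff _).1 hi)
      have : ((K i).map φ).Normal := Subgroup.Normal.map inferInstance φ hφ
      refine hΓ.commutator_ne_bot hna ih hi (le_bot_iff.1 ?_)
      rw [← h, ← Subgroup.map_commutator, Finset.inf_insert]
      refine Subgroup.map_mono (le_inf (Subgroup.commutator_le_right _ _) ?_)
      have hS : (S.inf K).Normal := Finset.inf_induction inferInstance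
        (fun _ _ _ _ => inferInstance) fun _ _ => inferInstance
      exact Subgroup.commutator_le_left _ _
  refine key Finset.univ ?_
  have hbot : Finset.univ.inf K = ⊥ := by
    rw [eq_bot_iff]
    intro x hx
    rw [Subgroup.mem_bot]
    refine Subtype.ext (funext fun i => ?_)
    exact (Finset.inf_le (f := K) (Finset.mem_univ i)) hx
  rw [hbot, Subgroup.map_bot]
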